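/- Let C_V^+ = {φ ∈ C_V : φ(θ) ≥ 0 for all θ ∈ T_3 ∖ {(−1,0,0)}}, a cone in C_V, and let φ ∈ C_V^+ be not identically zero. Then for every integer k ≥ 5 there exists a constant b_k > 0 such that (B^k φ)(θ) ≥ b_k for every θ ∈ T_3 ∖ {(−1,0,0)}. Consequently, B, acting on C_V, is a u_0-positive operator with respect to the cone C_V^+, where u_0 is the constant function 1. -/

import Mathlib

open MeasureTheory

noncomputable section

/-- The average integral `⨏_a^b f`, with the convention `⨏_a^a f = f a`. -/
def avg (a b : ℝ) (f : ℝ → ℝ) : ℝ :=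
  if a = b then f a else (b - a)⁻¹ * ∫ x in a..b, f x

/-- The simplex `T₃ = {θ ∈ [-1,0]³ : θ₁ ≤ θ₂ ≤ θ₃}`. -/
def T3set : Set (ℝ × ℝ × ℝ) :=
  {p | -1 ≤ p.1 ∧ p.1 ≤ p.2.1 ∧ p.2.1 ≤ p.2.2 ∧ p.2.2 ≤ 0}

/-- The exceptional point `(-1, 0, 0)`. -/
def badPt : ℝ × ℝ × ℝ := (-1, 0, 0)

/-- The kernel `Φ₀`. -/
def Phi0 (t₁ t₂ θ₁ θ₂ θ₃ : ℝ) : ℝ :=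
  ((t₂ - t₁) / (θ₃ - θ₁)) * t₁ * (t₂ / (1 + θ₁ - θ₂)) * (1 + t₁ - t₂)

/-- The kernel `Φ₁`. -/
def Phi1 (t₀ t₁ t₂ θ₁ θ₃ : ℝ) : ℝ :=
  (t₁ - t₀) * ((t₂ - t₁) / (θ₃ - θ₁)) * (t₂ - t₀) * (1 + t₀ - t₁)

/-- The operator `B₀`, extended to totally degenerate points `(θ⋆,θ⋆,θ⋆)` by
`(B₀φ)(θ⋆,θ⋆,θ⋆) = θ⋆² φ(θ⋆,θ⋆,0)/2`. -/
def B0op (φ : ℝ × ℝ × ℝ → ℝ) (p : ℝ × ℝ × ℝ) : ℝ :=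
  if p.1 = p.2.2 then p.1 ^ 2 * φ (p.1, p.1, 0) / 2
  else avg p.1 p.2.1 fun t₁ => avg p.2.1 p.2.2 fun t₂ =>
    Phi0 t₁ t₂ p.1 p.2.1 p.2.2 * φ (t₁, t₂, 0)

/-- The operator `B̃₁`, extended to totally degenerate points `(θ⋆,θ⋆,θ⋆)` by
`(B̃₁φ)(θ⋆,θ⋆,θ⋆) = (1/2) ⨏_{-1}^{θ⋆} (θ⋆-t)² (1+t-θ⋆) φ(t,θ⋆,θ⋆) dt`. -/
def Bt1op (φ : ℝ × ℝ × ℝ → ℝ) (p : ℝ × ℝ × ℝ) : ℝ :=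
  if p.1 = p.2.2 then
    (1 / 2) * avg (-1) p.1 fun t => (p.1 - t) ^ 2 * (1 + t - p.1) * φ (t, p.1, p.1)
  else avg (-1) p.1 fun t₀ => avg p.1 p.2.1 fun t₁ => avg p.2.1 p.2.2 fun t₂ =>
    Phi1 t₀ t₁ t₂ p.1 p.2.2 * φ (t₀, t₁, t₂)

/-- `ν₀(θ) = -(θ₂+θ₃)/(1+θ₁-θ₂)`. -/
def nu0 (p : ℝ × ℝ × ℝ) : ℝ := -(p.2.1 + p.2.2) / (1 + p.1 - p.2.1)

/-- `ν₁(θ) = (1+θ₁)/(1+θ₁-θ₂)`. -/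
def nu1 (p : ℝ × ℝ × ℝ) : ℝ := (1 + p.1) / (1 + p.1 - p.2.1)

/-- The operator `B₁ = ν₁ ⬝ B̃₁`. -/
def B1op (φ : ℝ × ℝ × ℝ → ℝ) (p : ℝ × ℝ × ℝ) : ℝ := nu1 p * Bt1op φ p

/-- The operator `B = B₀ + B₁`. -/
def Bop3 (φ : ℝ × ℝ × ℝ → ℝ) : ℝ × ℝ × ℝ → ℝ :=
  fun p => B0op φ p + B1op φ p

/-- Membership in `C_V = C(T₃)|_{T₃ ∖ {(-1,0,0)}} ⊕ span{ν₀, ν₁}` (only the values of `φ`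
on `T₃ ∖ {(-1,0,0)}` are relevant). -/
def InCV (φ : ℝ × ℝ × ℝ → ℝ) : Prop :=
  ∃ ψ : ℝ × ℝ × ℝ → ℝ, ContinuousOn ψ T3set ∧ ∃ c₀ c₁ : ℝ,
    ∀ p ∈ T3set \ {badPt}, φ p = ψ p + c₀ * nu0 p + c₁ * nu1 p

open Set Filter Topology

/-- The domain `T₃ ∖ {(-1,0,0)}`. -/
def SS : Set (ℝ × ℝ × ℝ) := T3set \ {badPt}

lemma avg_eq (a b : ℝ) (f : ℝ → ℝ) : avg a b f = ∫ s in (0:ℝ)..1, f (a + s * (b - a)) := by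
  unfold avg
  split_ifs with h
  · subst h; simp
  · have h' : b - a ≠ 0 := sub_ne_zero.mpr (Ne.symm h)
    have := intervalIntegral.integral_comp_add_mul (a := 0) (b := 1) f h' a
    simp only [mul_zero, add_zero, mul_one, add_sub_cancel, smul_eq_mul] at this
    rw [← this]
    simp only [mul_comm]

lemma avg_pt {a b s : ℝ} (hab : a ≤ b) (h0 : 0 ≤ s) (h1 : s ≤ 1) :
    a ≤ a + s * (b - a) ∧ a + s * (b - a) ≤ b := by
  constructor <;> nlinarith

lemma avg_congr' {a b : ℝ} (hab : a ≤ b) {f g : ℝ → ℝ}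
    (h : ∀ x, a ≤ x → x ≤ b → f x = g x) : avg a b f = avg a b g := by
  rw [avg_eq, avg_eq]
  apply intervalIntegral.integral_congr
  intro s hs
  rw [uIcc_of_le zero_le_one] at hs
  obtain ⟨h1, h2⟩ := avg_pt hab hs.1 hs.2
  exact h _ h1 h2

lemma avg_mem {a b K : ℝ} (hab : a ≤ b) {f : ℝ → ℝ}
    (h : ∀ x, a ≤ x → x ≤ b → 0 ≤ f x ∧ f x ≤ K) : 0 ≤ avg a b f ∧ avg a b f ≤ K := by
  rw [avg_eq]
  have hp : ∀ s ∈ Icc (0:ℝ) 1, 0 ≤ f (a + s * (b - a)) ∧ f (a + s * (b - a)) ≤ K := by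
    intro s hs
    obtain ⟨h1, h2⟩ := avg_pt hab hs.1 hs.2
    exact h _ h1 h2
  constructor
  · exact intervalIntegral.integral_nonneg zero_le_one (fun s hs => (hp s hs).1)
  · have := intervalIntegral.norm_integral_le_of_norm_le_const (a := 0) (b := 1)
      (f := fun s => f (a + s * (b - a))) (C := K) (by
        intro s hs
        rw [uIoc_of_le zero_le_one] at hs
        have := hp s ⟨hs.1.le, hs.2⟩
        rw [Real.norm_eq_abs, abs_of_nonneg this.1]; exact this.2)
    simp only [Real.norm_eq_abs, sub_zero, abs_one, mul_one] at this
    exact (le_abs_self _).trans this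

lemma avg_lower {a b K u v m : ℝ} (hab : a ≤ b) {f : ℝ → ℝ} (hf : Measurable f)
    (h : ∀ x, a ≤ x → x ≤ b → 0 ≤ f x ∧ f x ≤ K) (hu : 0 ≤ u) (huv : u ≤ v) (hv : v ≤ 1)
    (hm : ∀ s, u ≤ s → s ≤ v → m ≤ f (a + s * (b - a))) : (v - u) * m ≤ avg a b f := by
  rw [avg_eq]
  have hp : ∀ s ∈ Icc (0:ℝ) 1, 0 ≤ f (a + s * (b - a)) ∧ f (a + s * (b - a)) ≤ K := by
    intro s hs
    obtain ⟨h1, h2⟩ := avg_pt hab hs.1 hs.2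
    exact h _ h1 h2
  have hmeas : Measurable (fun s => f (a + s * (b - a))) := hf.comp (by fun_prop)
  have hint : IntervalIntegrable (fun s => f (a + s * (b - a))) volume 0 1 := by
    rw [intervalIntegrable_iff, uIoc_of_le zero_le_one]
    refine Measure.integrableOn_of_bounded (M := K) (by simp) hmeas.aestronglyMeasurable ?_
    refine (ae_restrict_iff' measurableSet_Ioc).mpr (Eventually.of_forall ?_)
    intro s hs
    have := hp s ⟨hs.1.le, hs.2⟩
    rw [Real.norm_eq_abs, abs_of_nonneg this.1]; exact this.2
  have hsub : IntervalIntegrable (fun s => f (a + s * (b - a))) volume u v := by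
    apply hint.mono_set
    rw [uIcc_of_le huv, uIcc_of_le zero_le_one]
    exact Icc_subset_Icc hu hv
  have h1 : ∫ s in u..v, f (a + s * (b - a)) ≤ ∫ s in (0:ℝ)..1, f (a + s * (b - a)) := by
    apply intervalIntegral.integral_mono_interval hu huv hv _ hint
    refine (ae_restrict_iff' measurableSet_Ioc).mpr (Eventually.of_forall ?_)
    intro s hs
    exact (hp s ⟨hs.1.le, hs.2⟩).1
  have h2 : ∫ s in u..v, m ≤ ∫ s in u..v, f (a + s * (b - a)) :=
    intervalIntegral.integral_mono_on huv (by simp) hsub (fun s hs => hm s hs.1 hs.2)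
  simp only [intervalIntegral.integral_const, smul_eq_mul] at h2
  exact h2.trans h1

lemma avg_meas {α : Type*} [MeasurableSpace α] {a b : α → ℝ} {F : α → ℝ → ℝ}
    (ha : Measurable a) (hb : Measurable b) (hF : Measurable (fun q : α × ℝ => F q.1 q.2)) :
    Measurable (fun x => avg (a x) (b x) (F x)) := by
  simp only [avg_eq, intervalIntegral.integral_of_le zero_le_one]
  have : Measurable (fun q : α × ℝ => F q.1 (a q.1 + q.2 * (b q.1 - a q.1))) := by
    exact hF.comp (f := fun q : α × ℝ => (q.1, a q.1 + q.2 * (b q.1 - a q.1))) (by fun_prop)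
  exact (this.stronglyMeasurable.integral_prod_right).measurable

lemma B0op_meas {f : ℝ × ℝ × ℝ → ℝ} (hf : Measurable f) : Measurable (B0op f) := by
  unfold B0op
  refine Measurable.ite (measurableSet_eq_fun (by fun_prop) (by fun_prop)) (by fun_prop) ?_
  refine avg_meas (by fun_prop) (by fun_prop) ?_
  refine avg_meas (α := (ℝ × ℝ × ℝ) × ℝ) (by fun_prop) (by fun_prop) ?_
  unfold Phi0
  fun_prop

lemma Bt1op_meas {f : ℝ × ℝ × ℝ → ℝ} (hf : Measurable f) : Measurable (Bt1op f) := by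
  unfold Bt1op
  refine Measurable.ite (measurableSet_eq_fun (by fun_prop) (by fun_prop)) ?_ ?_
  · refine Measurable.const_mul ?_ _
    refine avg_meas (by fun_prop) (by fun_prop) (by fun_prop)
  refine avg_meas (by fun_prop) (by fun_prop) ?_
  refine avg_meas (α := (ℝ × ℝ × ℝ) × ℝ) (by fun_prop) (by fun_prop) ?_
  refine avg_meas (α := ((ℝ × ℝ × ℝ) × ℝ) × ℝ) (by fun_prop) (by fun_prop) ?_
  unfold Phi1
  fun_prop

lemma Bop3_meas {f : ℝ × ℝ × ℝ → ℝ} (hf : Measurable f) : Measurable (Bop3 f) := by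
  unfold Bop3 B1op nu1
  have := B0op_meas hf
  have := Bt1op_meas hf
  fun_prop

lemma SS_mem {x y z : ℝ} : (x, y, z) ∈ SS ↔
    (-1 ≤ x ∧ x ≤ y ∧ y ≤ z ∧ z ≤ 0) ∧ ¬ (x = -1 ∧ y = 0 ∧ z = 0) := by
  simp [SS, T3set, badPt]

lemma SS_den {x y z : ℝ} (h : (x, y, z) ∈ SS) : 0 < 1 + x - y := by
  rw [SS_mem] at h
  obtain ⟨⟨h1, h2, h3, h4⟩, h5⟩ := h
  by_contra hc
  exact h5 ⟨by linarith, by linarith, by linarith⟩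

lemma SS_of_den {x y z : ℝ} (h1 : -1 ≤ x) (h2 : x ≤ y) (h3 : y ≤ z) (h4 : z ≤ 0)
    (h : 0 < 1 + x - y) : (x, y, z) ∈ SS := by
  rw [SS_mem]
  refine ⟨⟨h1, h2, h3, h4⟩, ?_⟩
  rintro ⟨rfl, rfl, rfl⟩
  norm_num at h

lemma Bop3_congr {f g : ℝ × ℝ × ℝ → ℝ} (h : ∀ p ∈ SS, f p = g p) :
    ∀ p ∈ SS, Bop3 f p = Bop3 g p := by
  rintro ⟨x, y, z⟩ hp
  have hp' := hp
  rw [SS_mem] at hp'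
  obtain ⟨⟨h1, h2, h3, h4⟩, h5⟩ := hp'
  have e0 : B0op f (x, y, z) = B0op g (x, y, z) := by
    unfold B0op
    simp only
    split_ifs with hd
    · rw [h]
      exact SS_of_den h1 le_rfl (by linarith) le_rfl (by linarith)
    · refine avg_congr' h2 fun t1 a1 b1 => avg_congr' h3 fun t2 a2 b2 => ?_
      rcases (show 0 ≤ 1 + t1 - t2 by linarith).eq_or_lt with e | e
      · simp [Phi0, ← e]
      · rw [h]
        exact SS_of_den (by linarith) (by linarith) (by linarith) le_rfl e
  have e1 : Bt1op f (x, y, z) = Bt1op g (x, y, z) := by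
    unfold Bt1op
    simp only
    split_ifs with hd
    · congr 1
      refine avg_congr' h1 fun t a b => ?_
      rcases (show 0 ≤ 1 + t - x by linarith).eq_or_lt with e | e
      · simp [← e]
      · rw [h]
        exact SS_of_den a b le_rfl (by linarith) e
    · refine avg_congr' h1 fun t0 a0 b0 => avg_congr' h2 fun t1 a1 b1 =>
        avg_congr' h3 fun t2 a2 b2 => ?_
      rcases (show 0 ≤ 1 + t0 - t1 by linarith).eq_or_lt with e | e
      · simp [Phi1, ← e]
      · rw [h]
        exact SS_of_den (by linarith) (by linarith) (by linarith) (by linarith) e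
  simp only [Bop3, B1op, e0, e1]

/-- Regular functions. -/
def Reg (f : ℝ × ℝ × ℝ → ℝ) (M : ℝ) : Prop := Measurable f ∧ ∀ p, 0 ≤ f p ∧ f p ≤ M

lemma mul01 {a b : ℝ} (ha : 0 ≤ a ∧ a ≤ 1) (hb : 0 ≤ b ∧ b ≤ 1) : 0 ≤ a * b ∧ a * b ≤ 1 :=
  ⟨mul_nonneg ha.1 hb.1, mul_le_one₀ ha.2 hb.1 hb.2⟩

lemma mul0M {a b M : ℝ} (ha : 0 ≤ a ∧ a ≤ 1) (hb : 0 ≤ b ∧ b ≤ M) : 0 ≤ a * b ∧ a * b ≤ M :=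
  ⟨mul_nonneg ha.1 hb.1, by nlinarith⟩

lemma div01 {a b : ℝ} (ha : 0 ≤ a) (hab : a ≤ b) : 0 ≤ a / b ∧ a / b ≤ 1 :=
  ⟨div_nonneg ha (ha.trans hab), div_le_one_of_le₀ hab (ha.trans hab)⟩

lemma Phi0_01 {x y z t1 t2 : ℝ} (hp : (x, y, z) ∈ SS) (a1 : x ≤ t1) (b1 : t1 ≤ y)
    (a2 : y ≤ t2) (b2 : t2 ≤ z) : 0 ≤ Phi0 t1 t2 x y z ∧ Phi0 t1 t2 x y z ≤ 1 := by
  obtain ⟨⟨h1, h2, h3, h4⟩, h5⟩ := SS_mem.1 hp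
  have e : Phi0 t1 t2 x y z =
    ((t2 - t1) / (z - x)) * (-t1) * ((-t2) / (1 + x - y)) * (1 + t1 - t2) := by
    unfold Phi0; ring
  rw [e]
  refine mul01 (mul01 (mul01 (div01 ?_ ?_) ⟨?_, ?_⟩) (div01 ?_ ?_)) ⟨?_, ?_⟩ <;> linarith

lemma Phi1_01 {x y z t0 t1 t2 : ℝ} (hp : (x, y, z) ∈ SS) (a0 : -1 ≤ t0) (b0 : t0 ≤ x)
    (a1 : x ≤ t1) (b1 : t1 ≤ y)
    (a2 : y ≤ t2) (b2 : t2 ≤ z) : 0 ≤ Phi1 t0 t1 t2 x z ∧ Phi1 t0 t1 t2 x z ≤ 1 := by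
  obtain ⟨⟨h1, h2, h3, h4⟩, h5⟩ := SS_mem.1 hp
  unfold Phi1
  refine mul01 (mul01 (mul01 ⟨?_, ?_⟩ (div01 ?_ ?_)) ⟨?_, ?_⟩) ⟨?_, ?_⟩ <;> linarith

lemma nu1_01 {p : ℝ × ℝ × ℝ} (hp : p ∈ SS) : 0 ≤ nu1 p ∧ nu1 p ≤ 1 := by
  obtain ⟨x, y, z⟩ := p
  obtain ⟨⟨h1, h2, h3, h4⟩, h5⟩ := SS_mem.1 hp
  unfold nu1
  simp only
  apply div01 <;> linarith

lemma B0op_bd {f : ℝ × ℝ × ℝ → ℝ} {M : ℝ} (hf : Reg f M) {p : ℝ × ℝ × ℝ} (hp : p ∈ SS) :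
    0 ≤ B0op f p ∧ B0op f p ≤ M := by
  obtain ⟨x, y, z⟩ := p
  obtain ⟨⟨h1, h2, h3, h4⟩, h5⟩ := SS_mem.1 hp
  unfold B0op
  simp only
  split_ifs with hd
  · have := mul0M (a := x ^ 2 / 2) ⟨by positivity, by nlinarith⟩ (hf.2 (x, x, 0))
    rw [show x ^ 2 * f (x, x, 0) / 2 = x ^ 2 / 2 * f (x, x, 0) by ring]
    exact this
  · exact avg_mem h2 fun t1 a1 b1 => avg_mem h3 fun t2 a2 b2 =>
      mul0M (Phi0_01 hp a1 b1 a2 b2) (hf.2 _)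

lemma deg_01 {x t : ℝ} (h1 : -1 ≤ t) (h2 : t ≤ x) (h3 : x ≤ 0) :
    0 ≤ (x - t) ^ 2 * (1 + t - x) ∧ (x - t) ^ 2 * (1 + t - x) ≤ 1 := by
  refine mul01 ⟨by positivity, ?_⟩ ⟨by linarith, by linarith⟩
  nlinarith

lemma Bt1op_bd {f : ℝ × ℝ × ℝ → ℝ} {M : ℝ} (hf : Reg f M) {p : ℝ × ℝ × ℝ} (hp : p ∈ SS) :
    0 ≤ Bt1op f p ∧ Bt1op f p ≤ M := by
  obtain ⟨x, y, z⟩ := p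
  obtain ⟨⟨h1, h2, h3, h4⟩, h5⟩ := SS_mem.1 hp
  unfold Bt1op
  simp only
  split_ifs with hd
  · refine mul0M ⟨by norm_num, by norm_num⟩ (avg_mem h1 fun t a b => ?_)
    exact mul0M (deg_01 a b (by linarith)) (hf.2 _)
  · exact avg_mem h1 fun t0 a0 b0 => avg_mem h2 fun t1 a1 b1 => avg_mem h3 fun t2 a2 b2 =>
      mul0M (Phi1_01 hp a0 b0 a1 b1 a2 b2) (hf.2 _)

lemma SS_meas : MeasurableSet SS := by
  unfold SS T3set
  refine MeasurableSet.diff ?_ (measurableSet_singleton _)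
  apply IsClosed.measurableSet
  refine IsClosed.and ?_ (IsClosed.and ?_ (IsClosed.and ?_ ?_)) <;>
    exact isClosed_le (by fun_prop) (by fun_prop)

/-- The truncated operator. -/
def Cop (f : ℝ × ℝ × ℝ → ℝ) : ℝ × ℝ × ℝ → ℝ := SS.indicator (Bop3 f)

lemma Cop_reg {f : ℝ × ℝ × ℝ → ℝ} {M : ℝ} (hf : Reg f M) : Reg (Cop f) (M + M) := by
  refine ⟨(Bop3_meas hf.1).indicator SS_meas, fun p => ?_⟩
  have hM : 0 ≤ M := (hf.2 p).1.trans (hf.2 p).2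
  unfold Cop
  by_cases hp : p ∈ SS
  · rw [indicator_of_mem hp]
    unfold Bop3 B1op
    have a := B0op_bd hf hp
    have b := mul0M (nu1_01 hp) (Bt1op_bd hf hp)
    constructor <;> linarith
  · rw [indicator_of_notMem hp]
    constructor <;> linarith

/-- `f` is locally bounded below by a positive constant near `x`. -/
def LB (f : ℝ × ℝ × ℝ → ℝ) (x : ℝ × ℝ × ℝ) : Prop :=
  ∃ c : ℝ, 0 < c ∧ ∀ᶠ p in 𝓝 x, p ∈ SS → c ≤ f p

lemma LB_open {f : ℝ × ℝ × ℝ → ℝ} {x : ℝ × ℝ × ℝ} (h : LB f x) : ∀ᶠ p in 𝓝 x, LB f p := by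
  obtain ⟨c, hc, h⟩ := h
  filter_upwards [eventually_eventually_nhds.2 h] with p hp
  exact ⟨c, hc, hp⟩

lemma path {E : Type*} [TopologicalSpace E] {P : E → Prop} {g : ℝ → E}
    (hg : Continuous g) (h : ∀ᶠ p in 𝓝 (g 0), P p) : ∃ e : ℝ, 0 < e ∧ e < 1 ∧ P (g e) := by
  have h1 : ∀ᶠ e in 𝓝[>] (0:ℝ), P (g e) :=
    (hg.continuousAt.eventually h).filter_mono nhdsWithin_le_nhds
  have h2 : ∀ᶠ e in 𝓝[>] (0:ℝ), e ∈ Ioo (0:ℝ) 1 := Ioo_mem_nhdsGT zero_lt_one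
  obtain ⟨e, h3, h4⟩ := (h1.and h2).exists
  exact ⟨e, h4.1, h4.2, h3⟩

lemma mid {e s : ℝ} (he : 0 < e) (he' : e < 1) (h0 : 0 ≤ s) (h1 : s ≤ 1) :
    0 < s + e * (1 / 2 - s) ∧ s + e * (1 / 2 - s) < 1 := by
  constructor <;> nlinarith

lemma param {a t b : ℝ} (h1 : a ≤ t) (h2 : t ≤ b) :
    ∃ s : ℝ, 0 ≤ s ∧ s ≤ 1 ∧ t = a + s * (b - a) := by
  rcases h1.eq_or_lt with e | e
  · exact ⟨0, by norm_num, by norm_num, by rw [e]; ring⟩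
  · have hb : 0 < b - a := by linarith
    refine ⟨(t - a) / (b - a), div_nonneg (by linarith) hb.le,
      div_le_one_of_le₀ (by linarith) hb.le, ?_⟩
    field_simp; ring

lemma weight {x y z s1 s2 k : ℝ} (h1 : x ≤ y) (h2 : y ≤ z) (hxz : x ≠ z)
    (hs1 : k ≤ 1 - s1) (hs2 : k ≤ s2) :
    k ≤ ((y + s2 * (z - y)) - (x + s1 * (y - x))) / (z - x) := by
  have : 0 < z - x := by
    rcases (show x ≤ z by linarith).eq_or_lt with e | e
    · exact absurd e hxz
    · linarith
  rw [le_div_iff₀ this]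
  nlinarith [mul_nonneg (sub_nonneg.2 hs1) (sub_nonneg.2 h1),
    mul_nonneg (sub_nonneg.2 hs2) (sub_nonneg.2 h2)]

lemma mul_lb {a b c d : ℝ} (h1 : a ≤ b) (h2 : c ≤ d) (ha : 0 ≤ a) (hc : 0 ≤ c) :
    a * c ≤ b * d := mul_le_mul h1 h2 hc (ha.trans h1)

set_option maxHeartbeats 2000000 in
lemma lemA {f : ℝ × ℝ × ℝ → ℝ} {M x y z t1 t2 : ℝ} (hf : Reg f M)
    (h1 : -1 ≤ x) (h4 : z ≤ 0) (hx : x < 0)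
    (a1 : x ≤ t1) (b1 : t1 ≤ y) (a2 : y ≤ t2) (b2 : t2 ≤ z) (hL : LB f (t1, t2, 0)) :
    ∃ c : ℝ, 0 < c ∧ ∀ᶠ p in 𝓝 (x, y, z), p ∈ SS →
      c * (-p.2.1 / (1 + p.1 - p.2.1)) ≤ B0op f p := by
  obtain ⟨s1, p1, q1, rfl⟩ := param a1 b1
  obtain ⟨s2, p2, q2, rfl⟩ := param a2 b2
  have h2 : x ≤ y := by linarith
  have h3 : y ≤ z := by linarith
  obtain ⟨e, he, he', hL⟩ := path (P := LB f)
    (g := fun e : ℝ => (x + (s1 + e * (1 / 2 - s1)) * (y - x),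
      y + (s2 + e * (1 / 2 - s2)) * (z - y), (0:ℝ))) (by fun_prop)
    (LB_open (by simpa using hL))
  obtain ⟨p1, q1⟩ := mid he he' p1 q1
  obtain ⟨p2, q2⟩ := mid he he' p2 q2
  generalize s1 + e * (1 / 2 - s1) = s1 at *
  generalize s2 + e * (1 / 2 - s2) = s2 at *
  obtain ⟨c, hc, hL⟩ := hL
  -- positivity of the kernel
  have k1 : 0 < -(x + s1 * (y - x)) := by nlinarith
  have k2 : 0 < 1 + (x + s1 * (y - x)) - (y + s2 * (z - y)) := by
    have m1 : 0 ≤ s1 * (y - x) := mul_nonneg p1.le (sub_nonneg.2 h2)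
    have m2 : s2 * z ≤ 0 := mul_nonpos_of_nonneg_of_nonpos p2.le h4
    rcases (show y ≤ 0 by linarith).eq_or_lt with e | e
    · have hz : z = 0 := by linarith
      rw [e, hz]; nlinarith
    · have m3 : (1 - s2) * y < 0 := mul_neg_of_pos_of_neg (by linarith) e
      linarith
  obtain ⟨k, hk, hkk⟩ : ∃ k : ℝ, 0 < k ∧ (k < s1 ∧ k < 1 - s1 ∧ k < s2 ∧ k < 1 - s2 ∧
      k < -(x + s1 * (y - x)) ∧ k < 1 + (x + s1 * (y - x)) - (y + s2 * (z - y))) := by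
    have : ∀ᶠ k in 𝓝[>] (0:ℝ), (k < s1 ∧ k < 1 - s1 ∧ k < s2 ∧ k < 1 - s2 ∧
      k < -(x + s1 * (y - x)) ∧ k < 1 + (x + s1 * (y - x)) - (y + s2 * (z - y))) := by
      apply Filter.Eventually.filter_mono nhdsWithin_le_nhds
      refine (eventually_lt_nhds ?_).and ((eventually_lt_nhds ?_).and ((eventually_lt_nhds ?_).and
        ((eventually_lt_nhds ?_).and ((eventually_lt_nhds ?_).and (eventually_lt_nhds ?_))))) <;>
      linarith
    obtain ⟨k, h, h'⟩ := (this.and self_mem_nhdsWithin).exists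
    exact ⟨k, h', h⟩
  obtain ⟨g1, g2, g3, g4, g5, g6⟩ := hkk
  have big : ∀ᶠ q : (ℝ × ℝ × ℝ) × ℝ × ℝ in 𝓝 ((x, y, z), s1, s2),
      ((q.1.1 + q.2.1 * (q.1.2.1 - q.1.1), q.1.2.1 + q.2.2 * (q.1.2.2 - q.1.2.1), (0:ℝ)) ∈ SS →
        c ≤ f (q.1.1 + q.2.1 * (q.1.2.1 - q.1.1), q.1.2.1 + q.2.2 * (q.1.2.2 - q.1.2.1), 0)) ∧
      k < q.2.1 ∧ k < 1 - q.2.1 ∧ k < q.2.2 ∧ k < 1 - q.2.2 ∧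
      k < -(q.1.1 + q.2.1 * (q.1.2.1 - q.1.1)) ∧
      k < 1 + (q.1.1 + q.2.1 * (q.1.2.1 - q.1.1)) - (q.1.2.1 + q.2.2 * (q.1.2.2 - q.1.2.1)) := by
    refine Eventually.and ?_ ?_
    · have hg : Continuous (fun q : (ℝ × ℝ × ℝ) × ℝ × ℝ =>
        (q.1.1 + q.2.1 * (q.1.2.1 - q.1.1), q.1.2.1 + q.2.2 * (q.1.2.2 - q.1.2.1), (0:ℝ))) := by
        fun_prop
      exact (hg.continuousAt (x := ((x, y, z), s1, s2))).eventually hL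
    · refine Eventually.and ?_ (Eventually.and ?_ (Eventually.and ?_ (Eventually.and ?_
        (Eventually.and ?_ ?_))))
      all_goals
        refine (isOpen_lt (by fun_prop) (by fun_prop)).mem_nhds ?_
        simp only [mem_ofPred_eq]
        assumption
  obtain ⟨ε, hε, hball⟩ := Metric.eventually_nhds_iff.1 big
  have key : ∀ p : ℝ × ℝ × ℝ, dist p (x, y, z) < ε → ∀ r1 r2 : ℝ, |r1 - s1| ≤ ε / 2 →
      |r2 - s2| ≤ ε / 2 → _ := fun p hp r1 r2 hr1 hr2 => hball (y := (p, r1, r2)) (by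
    simp only [Prod.dist_eq, Real.dist_eq, max_lt_iff] at hp ⊢
    exact ⟨hp, by linarith, by linarith⟩)
  clear hball big
  simp only at key
  refine ⟨ε * ε * (k * k * k * k * c) / 2 ⊓ (k * c / 2), by positivity, ?_⟩
  filter_upwards [Metric.ball_mem_nhds (x, y, z) hε] with p hp hpS
  obtain ⟨X, Y, Z⟩ := p
  have key := key _ (Metric.mem_ball.1 hp)
  obtain ⟨⟨H1, H2, H3, H4⟩, H5⟩ := SS_mem.1 hpS
  have Hd := SS_den hpS
  simp only
  have hW0 : 0 ≤ -Y / (1 + X - Y) := div_nonneg (by linarith) Hd.le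
  have key' : ∀ r1 r2 : ℝ, |r1 - s1| ≤ ε / 2 → |r2 - s2| ≤ ε / 2 →
      c ≤ f (X + r1 * (Y - X), Y + r2 * (Z - Y), 0) := by
    intro r1 r2 hr1 hr2
    obtain ⟨w0, w1, w2, w3, w4, w5, w6⟩ := key r1 r2 hr1 hr2
    apply w0
    obtain ⟨u1, u2⟩ := avg_pt (s := r1) H2 (by linarith) (by linarith)
    obtain ⟨u3, u4⟩ := avg_pt (s := r2) H3 (by linarith) (by linarith)
    exact SS_of_den (by linarith) (by linarith) (by linarith) le_rfl (by linarith)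
  have z0 : ∀ s : ℝ, |s - s| ≤ ε / 2 := by intro s; simp; linarith
  have hup : |s1 + ε / 2 - s1| ≤ ε / 2 ∧ |s2 + ε / 2 - s2| ≤ ε / 2 := by
    constructor <;> (rw [abs_le]; constructor <;> linarith)
  have hdn : |s1 - ε / 2 - s1| ≤ ε / 2 ∧ |s2 - ε / 2 - s2| ≤ ε / 2 := by
    constructor <;> (rw [abs_le]; constructor <;> linarith)
  unfold B0op
  simp only
  split_ifs with hd
  · have hXY : Y = X := by linarith
    have hZ : Z = X := by linarith
    subst hXY
    have w0 := key' s1 s2 (z0 _) (z0 _)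
    obtain ⟨-, -, -, -, -, w5, -⟩ := key s1 s2 (z0 _) (z0 _)
    rw [hZ] at w0
    simp only [sub_self, mul_zero, add_zero] at w0 w5
    simp only [add_sub_cancel_right, div_one]
    have : k * c / 2 * (-Y) ≤ Y ^ 2 * f (Y, Y, 0) / 2 := by
      have := mul_lb (mul_lb w5.le (le_refl (-Y)) hk.le (by linarith)) w0
        (mul_nonneg hk.le (by linarith)) hc.le
      nlinarith
    exact (mul_le_mul_of_nonneg_right inf_le_right (by linarith)).trans this
  · refine (mul_le_mul_of_nonneg_right inf_le_left hW0).trans ?_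
    have hdnk := key (s1 - ε / 2) (s2 - ε / 2) hdn.1 hdn.2
    have hupk := key (s1 + ε / 2) (s2 + ε / 2) hup.1 hup.2
    have hmeas : Measurable (fun q : ℝ × ℝ => Phi0 q.1 q.2 X Y Z * f (q.1, q.2, 0)) := by
      unfold Phi0
      have := hf.1
      fun_prop
    have step : ∀ r1, s1 - ε / 2 ≤ r1 → r1 ≤ s1 + ε / 2 →
        (s2 + ε / 2 - (s2 - ε / 2)) * (k * k * (k * (-Y / (1 + X - Y))) * k * c) ≤
        avg Y Z fun t₂ => Phi0 (X + r1 * (Y - X)) t₂ X Y Z * f (X + r1 * (Y - X), t₂, 0) := by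
      intro r1 hr1 hr1'
      have hr1a : |r1 - s1| ≤ ε / 2 := by rw [abs_le]; constructor <;> linarith
      obtain ⟨u1, u2⟩ := avg_pt (s := r1) H2 (by linarith) (by linarith)
      refine avg_lower (K := M) H3 (hmeas.comp (by fun_prop :
        Measurable fun t : ℝ => (X + r1 * (Y - X), t))) ?_ (by linarith) (by linarith)
        (by linarith) ?_
      · intro t2 a2 b2
        exact mul0M (Phi0_01 hpS u1 u2 a2 b2) (hf.2 _)
      · intro r2 hr2 hr2'
        have hr2a : |r2 - s2| ≤ ε / 2 := by rw [abs_le]; constructor <;> linarith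
        obtain ⟨-, w1, w2, w3, w4, w5, w6⟩ := key r1 r2 hr1a hr2a
        have hw := weight H2 H3 hd w2.le w3.le
        have e : Phi0 (X + r1 * (Y - X)) (Y + r2 * (Z - Y)) X Y Z =
          (((Y + r2 * (Z - Y)) - (X + r1 * (Y - X))) / (Z - X)) * (-(X + r1 * (Y - X))) *
            ((-(Y + r2 * (Z - Y))) / (1 + X - Y)) *
            (1 + (X + r1 * (Y - X)) - (Y + r2 * (Z - Y))) := by
          unfold Phi0; ring
        rw [e]
        have hY : k * (-Y / (1 + X - Y)) ≤ (-(Y + r2 * (Z - Y))) / (1 + X - Y) := by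
          rw [← mul_div_assoc]
          apply div_le_div_of_nonneg_right _ Hd.le
          have n1 : 0 ≤ (1 - r2 - k) * (-Y) := mul_nonneg (by linarith) (by linarith)
          have n2 : 0 ≤ r2 * (-Z) := mul_nonneg (by linarith) (by linarith)
          linarith
        refine mul_lb (mul_lb (mul_lb (mul_lb hw w5.le ?_ ?_) hY ?_ ?_) w6.le ?_ ?_)
          (key' _ _ hr1a hr2a) ?_ ?_ <;> positivity
    have step2 := avg_lower (K := M) (u := s1 - ε / 2) (v := s1 + ε / 2) H2
      (f := fun t₁ => avg Y Z fun t₂ => Phi0 t₁ t₂ X Y Z * f (t₁, t₂, 0))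
      (avg_meas (by fun_prop) (by fun_prop) hmeas)
      (fun t1 a1 b1 => avg_mem H3 fun t2 a2 b2 => mul0M (Phi0_01 hpS a1 b1 a2 b2) (hf.2 _))
      (by linarith) (by linarith) (by linarith) step
    refine le_trans ?_ step2
    have : 0 ≤ ε * ε * (k * k * k * k * c) * (-Y / (1 + X - Y)) := by positivity
    linarith

set_option maxHeartbeats 2000000 in
lemma lemB {f : ℝ × ℝ × ℝ → ℝ} {M x y z t0 t1 t2 : ℝ} (hf : Reg f M)
    (h4 : z ≤ 0) (hy : -1 < y) (a0 : -1 ≤ t0) (b0 : t0 ≤ x)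
    (a1 : x ≤ t1) (b1 : t1 ≤ y) (a2 : y ≤ t2) (b2 : t2 ≤ z) (hL : LB f (t0, t1, t2)) :
    ∃ c : ℝ, 0 < c ∧ ∀ᶠ p in 𝓝 (x, y, z), p ∈ SS → c ≤ Bt1op f p := by
  obtain ⟨s0, p0, q0, rfl⟩ := param a0 b0
  obtain ⟨s1, p1, q1, rfl⟩ := param a1 b1
  obtain ⟨s2, p2, q2, rfl⟩ := param a2 b2
  have h1 : -1 ≤ x := by linarith
  have h2 : x ≤ y := by linarith
  have h3 : y ≤ z := by linarith
  obtain ⟨e, he, he', hL⟩ := path (P := LB f)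
    (g := fun e : ℝ => (-1 + (s0 + e * (1 / 2 - s0)) * (x - -1),
      x + (s1 + e * (1 / 2 - s1)) * (y - x),
      y + (s2 + e * (1 / 2 - s2)) * (z - y))) (by fun_prop)
    (LB_open (by simpa using hL))
  obtain ⟨p0, q0⟩ := mid he he' p0 q0
  obtain ⟨p1, q1⟩ := mid he he' p1 q1
  obtain ⟨p2, q2⟩ := mid he he' p2 q2
  generalize s0 + e * (1 / 2 - s0) = s0 at *
  generalize s1 + e * (1 / 2 - s1) = s1 at *
  generalize s2 + e * (1 / 2 - s2) = s2 at *
  obtain ⟨c, hc, hL⟩ := hL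
  -- positivity of the kernel
  have k1 : 0 < (x + s1 * (y - x)) - (-1 + s0 * (x - -1)) := by
    rcases h1.eq_or_lt with e | e
    · rw [← e]; nlinarith
    · nlinarith [mul_nonneg p1.le (sub_nonneg.2 h2)]
  have k2 : 0 < 1 + (-1 + s0 * (x - -1)) - (x + s1 * (y - x)) := by
    rcases h1.eq_or_lt with e | e
    · rw [← e]; nlinarith
    · nlinarith [mul_nonneg (sub_nonneg.2 q1.le) (sub_nonneg.2 h2)]
  obtain ⟨k, hk, hkk⟩ : ∃ k : ℝ, 0 < k ∧ (k < s0 ∧ k < 1 - s0 ∧ k < s1 ∧ k < 1 - s1 ∧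
      k < s2 ∧ k < 1 - s2 ∧
      k < (x + s1 * (y - x)) - (-1 + s0 * (x - -1)) ∧
      k < 1 + (-1 + s0 * (x - -1)) - (x + s1 * (y - x))) := by
    have : ∀ᶠ k in 𝓝[>] (0:ℝ), (k < s0 ∧ k < 1 - s0 ∧ k < s1 ∧ k < 1 - s1 ∧
      k < s2 ∧ k < 1 - s2 ∧
      k < (x + s1 * (y - x)) - (-1 + s0 * (x - -1)) ∧
      k < 1 + (-1 + s0 * (x - -1)) - (x + s1 * (y - x))) := by
      apply Filter.Eventually.filter_mono nhdsWithin_le_nhds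
      refine (eventually_lt_nhds ?_).and ((eventually_lt_nhds ?_).and ((eventually_lt_nhds ?_).and
        ((eventually_lt_nhds ?_).and ((eventually_lt_nhds ?_).and ((eventually_lt_nhds ?_).and
        ((eventually_lt_nhds ?_).and (eventually_lt_nhds ?_))))))) <;>
      linarith
    obtain ⟨k, h, h'⟩ := (this.and self_mem_nhdsWithin).exists
    exact ⟨k, h', h⟩
  obtain ⟨g1, g2, g3, g4, g5, g6, g7, g8⟩ := hkk
  have big : ∀ᶠ q : (ℝ × ℝ × ℝ) × ℝ × ℝ × ℝ in 𝓝 ((x, y, z), s0, s1, s2),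
      ((-1 + q.2.1 * (q.1.1 - -1), q.1.1 + q.2.2.1 * (q.1.2.1 - q.1.1),
        q.1.2.1 + q.2.2.2 * (q.1.2.2 - q.1.2.1)) ∈ SS →
        c ≤ f (-1 + q.2.1 * (q.1.1 - -1), q.1.1 + q.2.2.1 * (q.1.2.1 - q.1.1),
        q.1.2.1 + q.2.2.2 * (q.1.2.2 - q.1.2.1))) ∧
      k < q.2.1 ∧ k < 1 - q.2.1 ∧ k < q.2.2.1 ∧ k < 1 - q.2.2.1 ∧
      k < q.2.2.2 ∧ k < 1 - q.2.2.2 ∧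
      k < (q.1.1 + q.2.2.1 * (q.1.2.1 - q.1.1)) - (-1 + q.2.1 * (q.1.1 - -1)) ∧
      k < 1 + (-1 + q.2.1 * (q.1.1 - -1)) - (q.1.1 + q.2.2.1 * (q.1.2.1 - q.1.1)) := by
    refine Eventually.and ?_ ?_
    · have hg : Continuous (fun q : (ℝ × ℝ × ℝ) × ℝ × ℝ × ℝ =>
        (-1 + q.2.1 * (q.1.1 - -1), q.1.1 + q.2.2.1 * (q.1.2.1 - q.1.1),
        q.1.2.1 + q.2.2.2 * (q.1.2.2 - q.1.2.1))) := by
        fun_prop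
      exact (hg.continuousAt (x := ((x, y, z), s0, s1, s2))).eventually hL
    · refine Eventually.and ?_ (Eventually.and ?_ (Eventually.and ?_ (Eventually.and ?_
        (Eventually.and ?_ (Eventually.and ?_ (Eventually.and ?_ ?_))))))
      all_goals
        refine (isOpen_lt (by fun_prop) (by fun_prop)).mem_nhds ?_
        simp only [mem_ofPred_eq]
        assumption
  obtain ⟨ε, hε, hball⟩ := Metric.eventually_nhds_iff.1 big
  have key : ∀ p : ℝ × ℝ × ℝ, dist p (x, y, z) < ε → ∀ r0 r1 r2 : ℝ, |r0 - s0| ≤ ε / 2 →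
      |r1 - s1| ≤ ε / 2 →
      |r2 - s2| ≤ ε / 2 → _ := fun p hp r0 r1 r2 hr0 hr1 hr2 =>
        hball (y := (p, r0, r1, r2)) (by
    simp only [Prod.dist_eq, Real.dist_eq, max_lt_iff] at hp ⊢
    exact ⟨hp, by linarith, by linarith, by linarith⟩)
  clear hball big
  simp only at key
  refine ⟨(ε * (ε * (ε * (k * k * k * k * c)))) ⊓ (1 / 2 * (ε * (k ^ 2 * k * c))),
    by positivity, ?_⟩
  filter_upwards [Metric.ball_mem_nhds (x, y, z) hε] with p hp hpS
  obtain ⟨X, Y, Z⟩ := p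
  have key := key _ (Metric.mem_ball.1 hp)
  obtain ⟨⟨H1, H2, H3, H4⟩, H5⟩ := SS_mem.1 hpS
  have Hd := SS_den hpS
  have key' : ∀ r0 r1 r2 : ℝ, |r0 - s0| ≤ ε / 2 → |r1 - s1| ≤ ε / 2 → |r2 - s2| ≤ ε / 2 →
      c ≤ f (-1 + r0 * (X - -1), X + r1 * (Y - X), Y + r2 * (Z - Y)) := by
    intro r0 r1 r2 hr0 hr1 hr2
    obtain ⟨w0, w1, w2, w3, w4, w5, w6, w7, w8⟩ := key r0 r1 r2 hr0 hr1 hr2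
    apply w0
    obtain ⟨u1, u2⟩ := avg_pt (s := r1) H2 (by linarith) (by linarith)
    obtain ⟨u3, u4⟩ := avg_pt (s := r2) H3 (by linarith) (by linarith)
    obtain ⟨u5, u6⟩ := avg_pt (s := r0) H1 (by linarith) (by linarith)
    exact SS_of_den (by linarith) (by linarith) (by linarith) (by linarith) (by linarith)
  have z0 : ∀ s : ℝ, |s - s| ≤ ε / 2 := by intro s; simp; linarith
  have hup : ∀ s : ℝ, |s + ε / 2 - s| ≤ ε / 2 := by
    intro s; rw [abs_le]; constructor <;> linarith
  have hdn : ∀ s : ℝ, |s - ε / 2 - s| ≤ ε / 2 := by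
    intro s; rw [abs_le]; constructor <;> linarith
  have hnear : ∀ s r : ℝ, s - ε / 2 ≤ r → r ≤ s + ε / 2 → |r - s| ≤ ε / 2 := by
    intro s r h h'; rw [abs_le]; constructor <;> linarith
  have hlen : ∀ s : ℝ, s + ε / 2 - (s - ε / 2) = ε := by intro s; ring
  have hdnk := key (s0 - ε / 2) (s1 - ε / 2) (s2 - ε / 2) (hdn _) (hdn _) (hdn _)
  have hupk := key (s0 + ε / 2) (s1 + ε / 2) (s2 + ε / 2) (hup _) (hup _) (hup _)
  have hfm := hf.1
  unfold Bt1op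
  simp only
  split_ifs with hd
  · refine inf_le_right.trans ?_
    refine mul_le_mul_of_nonneg_left ?_ (by norm_num)
    have hXY : Y = X := by linarith
    have hZ : Z = X := by linarith
    rw [← hlen s0]
    refine avg_lower (K := M) H1 (by fun_prop) ?_ (by linarith) (by linarith) (by linarith) ?_
    · intro t a b
      exact mul0M (deg_01 a b (by linarith)) (hf.2 _)
    · intro r0 hr0 hr0'
      have hr0a := hnear _ _ hr0 hr0'
      have w := key' r0 s1 s2 hr0a (z0 _) (z0 _)
      obtain ⟨-, -, -, -, -, -, -, w7, w8⟩ := key r0 s1 s2 hr0a (z0 _) (z0 _)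
      rw [hZ, hXY] at w
      rw [hXY] at w7 w8
      simp only [sub_self, mul_zero, add_zero] at w w7 w8
      refine mul_lb (mul_lb (pow_le_pow_left₀ hk.le w7.le 2) w8.le ?_ ?_) w ?_ ?_ <;> positivity
  · refine inf_le_left.trans ?_
    have hmeas : Measurable (fun q : (ℝ × ℝ) × ℝ =>
        Phi1 q.1.1 q.1.2 q.2 X Z * f (q.1.1, q.1.2, q.2)) := by
      unfold Phi1
      fun_prop
    have hmeas2 : Measurable (fun q : ℝ × ℝ => avg Y Z fun t₂ =>
        Phi1 q.1 q.2 t₂ X Z * f (q.1, q.2, t₂)) :=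
      avg_meas (by fun_prop) (by fun_prop) hmeas
    have hmeas3 : Measurable (fun t₀ : ℝ => avg X Y fun t₁ => avg Y Z fun t₂ =>
        Phi1 t₀ t₁ t₂ X Z * f (t₀, t₁, t₂)) :=
      avg_meas (by fun_prop) (by fun_prop) hmeas2
    rw [← hlen s0]
    refine avg_lower (K := M) H1 hmeas3 ?_ (by linarith) (by linarith) (by linarith) ?_
    · exact fun t0 a0 b0 => avg_mem H2 fun t1 a1 b1 => avg_mem H3 fun t2 a2 b2 =>
        mul0M (Phi1_01 hpS a0 b0 a1 b1 a2 b2) (hf.2 _)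
    intro r0 hr0 hr0'
    have hr0a := hnear _ _ hr0 hr0'
    obtain ⟨u0, v0⟩ := avg_pt (s := r0) H1 (by linarith) (by linarith)
    rw [hlen s0, ← hlen s1]
    refine avg_lower (K := M) H2 (hmeas2.comp (by fun_prop :
      Measurable fun t : ℝ => (-1 + r0 * (X - -1), t))) ?_ (by linarith) (by linarith)
      (by linarith) ?_
    · exact fun t1 a1 b1 => avg_mem H3 fun t2 a2 b2 =>
        mul0M (Phi1_01 hpS u0 v0 a1 b1 a2 b2) (hf.2 _)
    intro r1 hr1 hr1'
    have hr1a := hnear _ _ hr1 hr1'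
    obtain ⟨u1, v1⟩ := avg_pt (s := r1) H2 (by linarith) (by linarith)
    rw [hlen s1, ← hlen s2]
    refine avg_lower (K := M) H3 (hmeas.comp (by fun_prop :
      Measurable fun t : ℝ => ((-1 + r0 * (X - -1), X + r1 * (Y - X)), t))) ?_ (by linarith)
      (by linarith) (by linarith) ?_
    · exact fun t2 a2 b2 => mul0M (Phi1_01 hpS u0 v0 u1 v1 a2 b2) (hf.2 _)
    intro r2 hr2 hr2'
    have hr2a := hnear _ _ hr2 hr2'
    obtain ⟨u2, v2⟩ := avg_pt (s := r2) H3 (by linarith) (by linarith)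
    obtain ⟨-, w1, w2, w3, w4, w5, w6, w7, w8⟩ := key r0 r1 r2 hr0a hr1a hr2a
    have hw := weight H2 H3 hd w4.le w5.le
    have w9 : k ≤ (Y + r2 * (Z - Y)) - (-1 + r0 * (X - -1)) := by linarith
    unfold Phi1
    refine mul_lb (mul_lb (mul_lb (mul_lb w7.le hw ?_ ?_) w9 ?_ ?_) w8.le ?_ ?_)
      (key' _ _ _ hr0a hr1a hr2a) ?_ ?_ <;> positivity

lemma Cop_eq (f : ℝ × ℝ × ℝ → ℝ) {p : ℝ × ℝ × ℝ} (hp : p ∈ SS) :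
    Cop f p = B0op f p + nu1 p * Bt1op f p := by
  rw [Cop, indicator_of_mem hp]; rfl

lemma rule0 {f : ℝ × ℝ × ℝ → ℝ} {M x y z : ℝ} (hf : Reg f M)
    (h1 : -1 ≤ x) (h4 : z ≤ 0) (hy : y < 0) (t1 t2 : ℝ) (hL : LB f (t1, t2, 0))
    (a1 : x ≤ t1) (b1 : t1 ≤ y) (a2 : y ≤ t2) (b2 : t2 ≤ z) :
    LB (Cop f) (x, y, z) := by
  obtain ⟨c, hc, h⟩ := lemA hf h1 h4 (by linarith) a1 b1 a2 b2 hL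
  refine ⟨c * (-y / 2), mul_pos hc (by linarith), ?_⟩
  have hn : ∀ᶠ p : ℝ × ℝ × ℝ in 𝓝 (x, y, z), p.2.1 < y / 2 :=
    (isOpen_lt (by fun_prop) (by fun_prop)).mem_nhds (by simp only [mem_ofPred_eq]; linarith)
  filter_upwards [h, hn] with p hp hpn hpS
  rw [Cop_eq f hpS]
  have hB := mul_nonneg (nu1_01 hpS).1 (Bt1op_bd hf hpS).1
  have hp := hp hpS
  obtain ⟨X, Y, Z⟩ := p
  obtain ⟨⟨H1, H2, H3, H4⟩, H5⟩ := SS_mem.1 hpS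
  have Hd := SS_den hpS
  simp only at hp hpn
  have : c * (-y / 2) ≤ c * (-Y / (1 + X - Y)) := by
    apply mul_le_mul_of_nonneg_left _ hc.le
    rw [le_div_iff₀ Hd]
    nlinarith
  linarith

lemma rule1 {f : ℝ × ℝ × ℝ → ℝ} {M x y z : ℝ} (hf : Reg f M)
    (hx : -1 < x) (h4 : z ≤ 0) (t0 t1 t2 : ℝ) (hL : LB f (t0, t1, t2)) (a0 : -1 ≤ t0)
    (b0 : t0 ≤ x) (a1 : x ≤ t1) (b1 : t1 ≤ y) (a2 : y ≤ t2) (b2 : t2 ≤ z) :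
    LB (Cop f) (x, y, z) := by
  obtain ⟨c, hc, h⟩ := lemB hf h4 (by linarith) a0 b0 a1 b1 a2 b2 hL
  refine ⟨((1 + x) / 4) * c, mul_pos (by linarith) hc, ?_⟩
  have hn : ∀ᶠ p : ℝ × ℝ × ℝ in 𝓝 (x, y, z), (1 + x) / 2 < 1 + p.1 :=
    (isOpen_lt (by fun_prop) (by fun_prop)).mem_nhds (by simp only [mem_ofPred_eq]; linarith)
  filter_upwards [h, hn] with p hp hpn hpS
  rw [Cop_eq f hpS]
  have hB := (B0op_bd hf hpS).1
  have hp := hp hpS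
  have : (1 + x) / 4 ≤ nu1 p := by
    obtain ⟨X, Y, Z⟩ := p
    obtain ⟨⟨H1, H2, H3, H4⟩, H5⟩ := SS_mem.1 hpS
    have Hd := SS_den hpS
    simp only at hpn
    unfold nu1
    simp only
    rw [le_div_iff₀ Hd]
    nlinarith
  have := mul_lb this hp (by linarith) hc.le
  linarith

lemma ruleBad {f : ℝ × ℝ × ℝ → ℝ} {M : ℝ} (hf : Reg f M) (t t' : ℝ)
    (h1 : -1 ≤ t) (h2 : t ≤ 0) (h3 : -1 ≤ t') (h4 : t' ≤ 0)
    (hL : LB f (t, 0, 0)) (hL' : LB f (-1, t', 0)) : LB (Cop f) (-1, 0, 0) := by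
  obtain ⟨c, hc, h⟩ := lemA (z := 0) hf le_rfl le_rfl (by norm_num) h1 h2 le_rfl le_rfl hL
  obtain ⟨d, hd, h'⟩ := lemB (z := 0) hf le_rfl (by norm_num) le_rfl le_rfl h3 h4 le_rfl le_rfl hL'
  refine ⟨min c d, by positivity, ?_⟩
  filter_upwards [h, h'] with p hp hp' hpS
  rw [Cop_eq f hpS]
  have hp := hp hpS
  have hp' := mul_le_mul_of_nonneg_left (hp' hpS) (nu1_01 hpS).1
  have e : -p.2.1 / (1 + p.1 - p.2.1) + nu1 p = 1 := by
    have Hd : 0 < 1 + p.1 - p.2.1 := by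
      obtain ⟨X, Y, Z⟩ := p
      exact SS_den hpS
    unfold nu1
    field_simp
    ring
  have w0 : 0 ≤ -p.2.1 / (1 + p.1 - p.2.1) := by
    have := (nu1_01 hpS).2
    linarith
  have i1 := mul_le_mul_of_nonneg_right (min_le_left c d) w0
  have i2 := mul_le_mul_of_nonneg_left (min_le_right c d) (nu1_01 hpS).1
  have : min c d = min c d * (-p.2.1 / (1 + p.1 - p.2.1)) + nu1 p * min c d := by
    linear_combination (-min c d) * e
  linarith

/-- Positivity on the face `θ₃ = 0` away from the bad point gives positivity everywhere. -/
lemma full_of_face {f : ℝ × ℝ × ℝ → ℝ} {M : ℝ} (hf : Reg f M)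
    (h : ∀ x y : ℝ, (x, y, (0:ℝ)) ∈ SS → LB f (x, y, 0)) :
    ∀ p ∈ T3set, LB (Cop f) p := by
  rintro ⟨x, y, z⟩ ⟨h1, h2, h3, h4⟩
  simp only at h1 h2 h3 h4
  rcases (show y ≤ 0 by linarith).eq_or_lt with e | e
  · have hz : z = 0 := by linarith
    subst e hz
    rcases h1.eq_or_lt with e | e
    · rw [← e]
      refine ruleBad hf (-1/2) (-1/2) (by norm_num) (by norm_num) (by norm_num) (by norm_num)
        (h _ _ (SS_of_den ?_ ?_ ?_ ?_ ?_)) (h _ _ (SS_of_den ?_ ?_ ?_ ?_ ?_)) <;> norm_num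
    · exact rule1 hf e le_rfl x x 0 (h _ _ (SS_of_den h1 le_rfl h2 le_rfl (by linarith)))
        h1 le_rfl le_rfl h2 le_rfl le_rfl
  · exact rule0 hf h1 h4 e x y (h _ _ (SS_of_den h1 h2 e.le le_rfl (by linarith)))
      le_rfl h2 le_rfl h3

lemma Reg_iter {f : ℝ × ℝ × ℝ → ℝ} {M : ℝ} (hf : Reg f M) (k : ℕ) :
    ∃ M', Reg (Cop^[k] f) M' := by
  induction k with
  | zero => exact ⟨M, hf⟩
  | succ k ih =>
    obtain ⟨M', h⟩ := ih
    rw [Function.iterate_succ_apply']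
    exact ⟨_, Cop_reg h⟩

/-- The chase of positivity from an interior point. -/
lemma chase {f : ℝ × ℝ × ℝ → ℝ} {M a b c : ℝ} (hf : Reg f M) (ha : -1 < a) (hab : a < b)
    (hbc : b < c) (hc : c < 0) (hL : LB f (a, b, c)) :
    ∀ k : ℕ, 4 ≤ k → ∀ p ∈ T3set, LB (Cop^[k] f) p := by
  have hf1 := Cop_reg hf
  have hf2 := Cop_reg hf1
  have hf3 := Cop_reg hf2
  have P1 : ∀ x y z, a ≤ x → x ≤ b → b ≤ y → y ≤ c → c ≤ z → z ≤ 0 → LB (Cop f) (x, y, z) :=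
    fun x y z h1 h2 h3 h4 h5 h6 => rule1 hf (by linarith) h6 a b c hL ha.le h1 h2 h3 h4 h5
  have P2X : ∀ x y z, -1 ≤ x → x ≤ b → x ≤ y → a ≤ y → y ≤ c → y ≤ z → b ≤ z → z ≤ 0 →
      LB (Cop (Cop f)) (x, y, z) := by
    intro x y z h1 h2 h3 h4 h5 h6 h7 h8
    refine rule0 hf1 h1 h8 (by linarith) (max x a) (max y b)
      (P1 _ _ _ (le_max_right _ _) (max_le h2 hab.le) (le_max_right _ _) (max_le h5 hbc.le) hc.le
        le_rfl) (le_max_left _ _) (max_le h3 h4) (le_max_left _ _) (max_le h6 h7)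
  have P2Y : ∀ x y z, a ≤ x → x ≤ c → x ≤ y → b ≤ y → y ≤ z → c ≤ z → z ≤ 0 →
      LB (Cop (Cop f)) (x, y, z) := by
    intro x y z h1 h2 h3 h4 h5 h6 h7
    refine rule1 hf1 (by linarith) h7 a (max x b) z
      (P1 _ _ _ le_rfl hab.le (le_max_right _ _) (max_le h2 hbc.le) h6 h7) ha.le h1
      (le_max_left _ _) (max_le h3 h4) h5 le_rfl
  have P3 : ∀ x y : ℝ, (x, y, (0:ℝ)) ∈ SS → LB (Cop (Cop (Cop f))) (x, y, 0) := by
    intro x y hS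
    obtain ⟨⟨h1, h2, h3, -⟩, h5⟩ := SS_mem.1 hS
    by_cases hyc : y ≤ c
    · by_cases hxb : x ≤ b
      · -- X0
        refine rule0 hf2 h1 le_rfl (by linarith) x (max y a)
          (P2X _ _ _ h1 hxb (h2.trans (le_max_left _ _)) (le_max_right _ _)
            (max_le hyc (by linarith)) (max_le h3 (by linarith)) (by linarith) le_rfl)
          le_rfl h2 (le_max_left _ _) (max_le h3 (by linarith))
      · refine rule0 hf2 h1 le_rfl (by linarith) x y
          (P2Y _ _ _ (by linarith) (by linarith) h2 (by linarith) h3 hc.le le_rfl)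
          le_rfl h2 le_rfl h3
    · push Not at hyc
      by_cases hxc : x ≤ c
      · by_cases hy0 : y = 0
        · have hx : -1 < x := by
            rcases h1.eq_or_lt with e | e
            · exact absurd ⟨e.symm, hy0, rfl⟩ h5
            · exact e
          refine rule1 hf2 hx le_rfl (min x b) (max x a) 0
            (P2X _ _ _ (le_min h1 (by linarith)) (min_le_right _ _)
              ((min_le_left _ _).trans (le_max_left _ _)) (le_max_right _ _)
              (max_le hxc (by linarith)) (max_le (by linarith) (by linarith)) (by linarith) le_rfl)
            (le_min h1 (by linarith)) (min_le_left _ _) (le_max_left _ _)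
            (max_le h2 (by linarith)) h3 le_rfl
        · have hy : y < 0 := lt_of_le_of_ne h3 hy0
          refine rule0 hf2 h1 le_rfl hy (max x a) y
            (P2Y _ _ _ (le_max_right _ _) (max_le hxc (by linarith)) (max_le h2 (by linarith))
              (by linarith) h3 hc.le le_rfl)
            (le_max_left _ _) (max_le h2 (by linarith)) le_rfl h3
      · push Not at hxc
        refine rule1 hf2 (by linarith) le_rfl c x 0
          (P2Y _ _ _ (by linarith) le_rfl hxc.le (by linarith) (by linarith) hc.le le_rfl)
          (by linarith) hxc.le le_rfl h2 h3 le_rfl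
  have P4 := full_of_face hf3 P3
  intro k hk
  induction k, hk using Nat.le_induction with
  | base => exact P4
  | succ k hk ih =>
    obtain ⟨M', h⟩ := Reg_iter hf k
    rw [Function.iterate_succ_apply']
    exact full_of_face h (fun x y hS => ih _ hS.1)

lemma T3_compact : IsCompact T3set := by
  apply Metric.isCompact_of_isClosed_isBounded
  · refine IsClosed.and ?_ (IsClosed.and ?_ (IsClosed.and ?_ ?_)) <;>
      exact isClosed_le (by fun_prop) (by fun_prop)
  · refine (Metric.isBounded_Icc ((-1, -1, -1) : ℝ × ℝ × ℝ) (0, 0, 0)).subset ?_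
    rintro ⟨x, y, z⟩ ⟨h1, h2, h3, h4⟩
    simp only at h1 h2 h3 h4
    refine ⟨⟨?_, ?_, ?_⟩, ⟨?_, ?_, ?_⟩⟩ <;> simp only <;> linarith

lemma unif {f : ℝ × ℝ × ℝ → ℝ} (h : ∀ p ∈ T3set, LB f p) :
    ∃ b : ℝ, 0 < b ∧ ∀ p ∈ SS, b ≤ f p := by
  have := T3_compact.induction_on (p := fun s => ∃ b : ℝ, 0 < b ∧ ∀ p ∈ s, p ∈ SS → b ≤ f p)
    ⟨1, one_pos, by simp⟩
    (fun s t hst ⟨b, hb, h⟩ => ⟨b, hb, fun p hp => h p (hst hp)⟩)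
    (fun s t ⟨b, hb, h⟩ ⟨b', hb', h'⟩ => ⟨min b b', by positivity, fun p hp hS =>
      hp.elim (fun hp => (min_le_left _ _).trans (h p hp hS))
        (fun hp => (min_le_right _ _).trans (h' p hp hS))⟩)
    (fun x hx => by
      obtain ⟨c, hc, h⟩ := h x hx
      exact ⟨_, nhdsWithin_le_nhds h, c, hc, fun p hp hS => hp hS⟩)
  obtain ⟨b, hb, h⟩ := this
  exact ⟨b, hb, fun p hp => h p hp.1 hp⟩

lemma iter_eq (φ : ℝ × ℝ × ℝ → ℝ) (k : ℕ) :
    ∀ p ∈ SS, Bop3^[k] φ p = Cop^[k] (SS.indicator φ) p := by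
  induction k with
  | zero => intro p hp; simp [indicator_of_mem hp]
  | succ k ih =>
    intro p hp
    rw [Function.iterate_succ_apply', Function.iterate_succ_apply', Bop3_congr ih p hp,
      Cop, indicator_of_mem hp]

lemma nu0_02 {p : ℝ × ℝ × ℝ} (hp : p ∈ SS) : |nu0 p| ≤ 2 := by
  obtain ⟨x, y, z⟩ := p
  obtain ⟨⟨h1, h2, h3, h4⟩, h5⟩ := SS_mem.1 hp
  have Hd := SS_den hp
  unfold nu0
  simp only
  rw [abs_of_nonneg (div_nonneg (by linarith) Hd.le), div_le_iff₀ Hd]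
  linarith

lemma InCV_cont {φ : ℝ × ℝ × ℝ → ℝ} (h : InCV φ) : ContinuousOn φ SS := by
  obtain ⟨ψ, hψ, c0, c1, h⟩ := h
  refine ContinuousOn.congr ?_ h
  have hd : ∀ p ∈ SS, 1 + p.1 - p.2.1 ≠ 0 := by
    rintro ⟨x, y, z⟩ hp
    exact (SS_den hp).ne'
  have hn0 : ContinuousOn nu0 SS := by
    unfold nu0
    exact ContinuousOn.div (by fun_prop) (by fun_prop) hd
  have hn1 : ContinuousOn nu1 SS := by
    unfold nu1
    exact ContinuousOn.div (by fun_prop) (by fun_prop) hd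
  have hψ' : ContinuousOn ψ SS := hψ.mono sdiff_subset
  fun_prop

lemma InCV_reg {φ : ℝ × ℝ × ℝ → ℝ} (h : InCV φ) (hpos : ∀ p ∈ SS, 0 ≤ φ p) :
    ∃ M, Reg (SS.indicator φ) M := by
  classical
  have hc := InCV_cont h
  obtain ⟨ψ, hψ, c0, c1, h⟩ := h
  obtain ⟨C, hC⟩ := T3_compact.exists_bound_of_continuousOn hψ
  have hC0 : 0 ≤ C := (norm_nonneg _).trans (hC (-1, 0, 0) (by simp [T3set]))
  refine ⟨C + |c0| * 2 + |c1| * 1, ?_, fun p => ?_⟩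
  · rw [← piecewise_eq_indicator]
    exact hc.measurable_piecewise continuousOn_const SS_meas
  · by_cases hp : p ∈ SS
    · rw [indicator_of_mem hp]
      refine ⟨hpos p hp, ?_⟩
      rw [h p hp]
      have i1 := (le_abs_self _).trans (hC p hp.1)
      have i2 : c0 * nu0 p ≤ |c0| * 2 := by
        refine (le_abs_self _).trans ?_
        rw [abs_mul]
        exact mul_le_mul_of_nonneg_left (nu0_02 hp) (abs_nonneg _)
      have i3 : c1 * nu1 p ≤ |c1| * 1 := by
        refine (le_abs_self _).trans ?_
        rw [abs_mul, abs_of_nonneg (nu1_01 hp).1]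
        exact mul_le_mul_of_nonneg_left (nu1_01 hp).2 (abs_nonneg _)
      linarith
    · rw [indicator_of_notMem hp]
      exact ⟨le_rfl, by positivity⟩

lemma start {φ : ℝ × ℝ × ℝ → ℝ} (h : InCV φ) (hpos : ∀ p ∈ SS, 0 ≤ φ p)
    (hne : ∃ p ∈ SS, φ p ≠ 0) :
    ∃ a b c : ℝ, -1 < a ∧ a < b ∧ b < c ∧ c < 0 ∧ LB (SS.indicator φ) (a, b, c) := by
  obtain ⟨p, hp, hne⟩ := hne
  have hp0 : 0 < φ p := lt_of_le_of_ne (hpos p hp) (Ne.symm hne)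
  have hL : LB (SS.indicator φ) p := by
    refine ⟨φ p / 2, by linarith, ?_⟩
    have := (InCV_cont h p hp).eventually (lt_mem_nhds (show φ p / 2 < φ p by linarith))
    rw [eventually_nhdsWithin_iff] at this
    filter_upwards [this] with q hq hqS
    rw [indicator_of_mem hqS]
    exact (hq hqS).le
  obtain ⟨x, y, z⟩ := p
  obtain ⟨⟨h1, h2, h3, h4⟩, h5⟩ := SS_mem.1 hp
  obtain ⟨e, he, he', hL⟩ := path (P := LB (SS.indicator φ))
    (g := fun e : ℝ => (x + e * (-3/4 - x), y + e * (-1/2 - y), z + e * (-1/4 - z)))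
    (by fun_prop) (LB_open (by simpa using hL))
  refine ⟨_, _, _, ?_, ?_, ?_, ?_, hL⟩ <;> nlinarith

theorem statement19 (φ : ℝ × ℝ × ℝ → ℝ) (hφCV : InCV φ)
    (hφpos : ∀ p ∈ T3set \ {badPt}, 0 ≤ φ p)
    (hφne : ∃ p ∈ T3set \ {badPt}, φ p ≠ 0) :
    (∀ k : ℕ, 5 ≤ k → ∃ b : ℝ, 0 < b ∧ ∀ p ∈ T3set \ {badPt}, b ≤ Bop3^[k] φ p) ∧
    (∀ k : ℕ, 5 ≤ k → ∃ C₁ C₂ : ℝ, 0 < C₁ ∧ C₁ ≤ C₂ ∧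
      ∀ p ∈ T3set \ {badPt}, C₁ ≤ Bop3^[k] φ p ∧ Bop3^[k] φ p ≤ C₂) := by
  have hpos : ∀ p ∈ SS, 0 ≤ φ p := hφpos
  obtain ⟨M, hR⟩ := InCV_reg hφCV hpos
  obtain ⟨a, b, c, ha, hab, hbc, hc, hL⟩ := start hφCV hpos hφne
  have main : ∀ k : ℕ, 5 ≤ k → ∃ b : ℝ, 0 < b ∧ ∀ p ∈ SS, b ≤ Bop3^[k] φ p := by
    intro k hk
    obtain ⟨b, hb, h⟩ := unif (chase hR ha hab hbc hc hL k (by omega))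
    exact ⟨b, hb, fun p hp => by rw [iter_eq φ k p hp]; exact h p hp⟩
  refine ⟨main, fun k hk => ?_⟩
  obtain ⟨b, hb, h⟩ := main k hk
  obtain ⟨M', hM⟩ := Reg_iter hR k
  refine ⟨b, max b M', hb, le_max_left _ _, fun p hp => ⟨h p hp, ?_⟩⟩
  rw [iter_eq φ k p hp]
  exact (hM.2 p).2.trans (le_max_right _ _)
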